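/- arXiv:math/0404380 — 2 statements merged into one kernel-verified Lean document; each statement's English description precedes it below -/
import Mathlib

section
/- Let (X,d) be a proper, uniquely geodesic, geodesically complete metric space in which geodesics do not split, and let I be a surjective isometry of the space 𝔉(X,d) of nonempty compact subsets of X, endowed with the Hausdorff metric d_H. Then there exists an isometry i of (X,d) onto itself such that I(C) = i(C) (the image of C under i) for all C in 𝔉(X,d). -/
open Metric Set TopologicalSpace

variable {X : Type*}

/-- A geodesic segment from `x` to `y`, parametrized by arclength on `[0, dist x y]`. -/
def IsGeodesicSegment [MetricSpace X] (γ : ℝ → X) (x y : X) : Prop :=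
  γ 0 = x ∧ γ (dist x y) = y ∧
    ∀ s ∈ Set.Icc (0 : ℝ) (dist x y), ∀ t ∈ Set.Icc (0 : ℝ) (dist x y),
      dist (γ s) (γ t) = |s - t|

/-- A metric space is geodesic if any two points are joined by a geodesic segment. -/
def IsGeodesicSpace (X : Type*) [MetricSpace X] : Prop :=
  ∀ x y : X, ∃ γ : ℝ → X, IsGeodesicSegment γ x y

/-- A metric space is uniquely geodesic if any two points are joined by a geodesic
segment, which is moreover unique (as a parametrized segment). -/
def IsUniquelyGeodesic (X : Type*) [MetricSpace X] : Prop :=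
  ∀ x y : X, (∃ γ : ℝ → X, IsGeodesicSegment γ x y) ∧
    ∀ γ γ' : ℝ → X, IsGeodesicSegment γ x y → IsGeodesicSegment γ' x y →
      ∀ t ∈ Set.Icc (0 : ℝ) (dist x y), γ t = γ' t

/-- Geodesic completeness: every geodesic segment extends to a full geodesic line,
i.e. an isometric embedding of `ℝ`. -/
def IsGeodesicallyComplete (X : Type*) [MetricSpace X] : Prop :=
  ∀ (x y : X) (γ : ℝ → X), IsGeodesicSegment γ x y →
    ∃ γ' : ℝ → X, Isometry γ' ∧ γ '' Set.Icc (0 : ℝ) (dist x y) ⊆ Set.range γ'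

/-- Geodesics do not split: the image of the bi-infinite geodesic extension of every
nondegenerate geodesic segment is unique. -/
def GeodesicsDoNotSplit (X : Type*) [MetricSpace X] : Prop :=
  ∀ (x y : X) (γ : ℝ → X), IsGeodesicSegment γ x y → x ≠ y →
    ∀ γ₁ γ₂ : ℝ → X, Isometry γ₁ → Isometry γ₂ →
      γ '' Set.Icc (0 : ℝ) (dist x y) ⊆ Set.range γ₁ →
      γ '' Set.Icc (0 : ℝ) (dist x y) ⊆ Set.range γ₂ →
      Set.range γ₁ = Set.range γ₂

/-- A subset is (geodesically) convex if with any two of its points it contains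
the image of every geodesic segment joining them. -/
def IsGeodConvex [MetricSpace X] (C : Set X) : Prop :=
  ∀ a ∈ C, ∀ b ∈ C, ∀ γ : ℝ → X, IsGeodesicSegment γ a b →
    γ '' Set.Icc (0 : ℝ) (dist a b) ⊆ C

/-- A midpoint map on a metric space: a symmetric map `m` with
`d(m(x,y),x) = d(x,y)/2 = d(m(x,y),y)`. -/
def IsMidpointMap [MetricSpace X] (m : X → X → X) : Prop :=
  (∀ x y, m x y = m y x) ∧
    ∀ x y, dist (m x y) x = dist x y / 2 ∧ dist (m x y) y = dist x y / 2

/-- A convex midpoint map: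
`d(m(x₁,y₁), m(x₂,y₂)) ≤ (d(x₁,x₂) + d(y₁,y₂))/2` for all points. -/
def IsConvexMidpointMap [MetricSpace X] (m : X → X → X) : Prop :=
  IsMidpointMap m ∧
    ∀ x₁ x₂ y₁ y₂ : X, dist (m x₁ y₁) (m x₂ y₂) ≤ (dist x₁ x₂ + dist y₁ y₂) / 2

/-- The space `𝒞(X,d)` of nonempty convex compact subsets of `X`, endowed with the
Hausdorff metric (as a subtype of `NonemptyCompacts X`, whose metric is the
Hausdorff distance). -/
abbrev ConvexCompacts (X : Type*) [MetricSpace X] :=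
  {A : NonemptyCompacts X // IsGeodConvex (A : Set X)}

lemma isGeodConvex_singleton [MetricSpace X] (p : X) : IsGeodConvex ({p} : Set X) := by
  rintro a ha b hb γ hγ x ⟨t, ht, rfl⟩
  rw [Set.mem_singleton_iff] at ha hb
  subst ha; subst hb
  rw [dist_self] at ht
  have : t = 0 := le_antisymm ht.2 ht.1
  subst this
  exact hγ.1

/-- The singleton `{p}` as an element of `𝒞(X,d)`. -/
def singletonCC [MetricSpace X] (p : X) : ConvexCompacts X :=
  ⟨⟨⟨{p}, isCompact_singleton⟩, Set.singleton_nonempty p⟩, isGeodConvex_singleton p⟩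

/-- The singleton `{p}` as an element of `𝔉(X,d)`, the space of nonempty compact
subsets of `X` with the Hausdorff metric. -/
def singletonNC [MetricSpace X] (p : X) : NonemptyCompacts X :=
  ⟨⟨{p}, isCompact_singleton⟩, Set.singleton_nonempty p⟩

/-- The closed `r`-neighborhood `N_r(A) = {x | ∃ a ∈ A, d(a,x) ≤ r}` of a set. -/
def closedNbhd [MetricSpace X] (r : ℝ) (A : Set X) : Set X :=
  {x : X | ∃ a ∈ A, dist a x ≤ r}

/-- A set is `m`-convex if it contains the `m`-midpoint of each pair of its points. -/
def MConvexSet [MetricSpace X] (m : X → X → X) (A : Set X) : Prop :=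
  ∀ a ∈ A, ∀ a' ∈ A, m a a' ∈ A

/-- The `m`-convex hull: the intersection of all closed `m`-convex sets containing `A`. -/
def mConvexHull [MetricSpace X] (m : X → X → X) (A : Set X) : Set X :=
  ⋂₀ {C : Set X | IsClosed C ∧ MConvexSet m C ∧ A ⊆ C}

/-! ### The Hausdorff distance between nonempty compact sets -/

section HausdorffDistance

variable [MetricSpace X]

lemma dist_nonemptyCompacts_le {A B : NonemptyCompacts X} {r : ℝ} (hr : 0 ≤ r)
    (hAB : ∀ a ∈ A, ∃ b ∈ B, dist a b ≤ r) (hBA : ∀ b ∈ B, ∃ a ∈ A, dist b a ≤ r) :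
    dist A B ≤ r := by
  rw [Metric.NonemptyCompacts.dist_eq]
  exact hausdorffDist_le_of_mem_dist hr hAB hBA

lemma exists_dist_le_dist_nonemptyCompacts {A : NonemptyCompacts X} (B : NonemptyCompacts X)
    {a : X} (ha : a ∈ A) : ∃ b ∈ B, dist a b ≤ dist A B := by
  obtain ⟨b, hb, hab⟩ := B.isCompact.exists_infDist_eq_dist B.nonempty a
  refine ⟨b, hb, hab ▸ ?_⟩
  rw [Metric.NonemptyCompacts.dist_eq]
  exact infDist_le_hausdorffDist_of_mem ha (hausdorffEDist_ne_top_of_nonempty_of_bounded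
    A.nonempty B.nonempty A.isCompact.isBounded B.isCompact.isBounded)

/-- The Hausdorff distance is attained at a point of one of the two sets. -/
lemma dist_nonemptyCompacts_attained (A B : NonemptyCompacts X) :
    (∃ a ∈ A, ∀ b ∈ B, dist A B ≤ dist a b) ∨ (∃ b ∈ B, ∀ a ∈ A, dist A B ≤ dist b a) := by
  obtain ⟨a, ha, hamax⟩ := A.isCompact.exists_isMaxOn A.nonempty
    (continuous_infDist_pt (B : Set X)).continuousOn
  obtain ⟨b, hb, hbmax⟩ := B.isCompact.exists_isMaxOn B.nonempty
    (continuous_infDist_pt (A : Set X)).continuousOn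
  have key : dist A B ≤ max (infDist a B) (infDist b A) := by
    rw [Metric.NonemptyCompacts.dist_eq]
    exact hausdorffDist_le_of_infDist (le_max_of_le_left infDist_nonneg)
      (fun x hx => le_max_of_le_left (hamax hx)) (fun x hx => le_max_of_le_right (hbmax hx))
  rcases le_max_iff.1 key with h | h
  · exact Or.inl ⟨a, ha, fun y hy => h.trans (infDist_le_dist_of_mem hy)⟩
  · exact Or.inr ⟨b, hb, fun y hy => h.trans (infDist_le_dist_of_mem hy)⟩

lemma dist_le_dist_singleton {A : NonemptyCompacts X} {a : X} (ha : a ∈ A) (p : X) :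
    dist p a ≤ dist {p} A := by
  obtain ⟨b, hb, hab⟩ := exists_dist_le_dist_nonemptyCompacts {p} ha
  rw [(NonemptyCompacts.mem_singleton b p).1 hb] at hab
  rwa [dist_comm p, dist_comm _ A]

lemma dist_singleton_le {A : NonemptyCompacts X} {p : X} {r : ℝ} (h : ∀ a ∈ A, dist p a ≤ r) :
    dist {p} A ≤ r := by
  obtain ⟨a, ha⟩ := A.nonempty
  refine dist_nonemptyCompacts_le (dist_nonneg.trans (h a ha)) ?_
    (fun b hb => ⟨p, rfl, dist_comm p b ▸ h b hb⟩)
  rintro x hx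
  rw [(NonemptyCompacts.mem_singleton x p).1 hx]
  exact ⟨a, ha, h a ha⟩

lemma exists_dist_singleton_eq (A : NonemptyCompacts X) (p : X) :
    ∃ a ∈ A, dist {p} A = dist p a := by
  obtain ⟨a, ha, hmax⟩ := A.isCompact.exists_isMaxOn A.nonempty
    (f := fun x => dist p x) (by fun_prop)
  exact ⟨a, ha, le_antisymm (dist_singleton_le fun x hx => hmax hx) (dist_le_dist_singleton ha p)⟩

/-- A nonempty closed bounded subset of a proper space as a nonempty compact set. -/
lemma exists_nonemptyCompacts_coe_eq [ProperSpace X] {S : Set X} (hS : IsClosed S)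
    {p : X} {r : ℝ} (hr : ∀ x ∈ S, dist p x ≤ r) (hne : S.Nonempty) :
    ∃ A : NonemptyCompacts X, ∀ x, x ∈ A ↔ x ∈ S :=
  ⟨⟨⟨S, (isCompact_closedBall p r).of_isClosed_subset hS
    fun x hx => by simpa [dist_comm] using hr x hx⟩, hne⟩, fun _ => Iff.rfl⟩

end HausdorffDistance

/-! ### Geodesics -/

section Geodesics

variable [MetricSpace X]

lemma Isometry.dist_eq_abs {γ : ℝ → X} (hγ : Isometry γ) (s t : ℝ) :
    dist (γ s) (γ t) = |s - t| := by
  rw [hγ.dist_eq, Real.dist_eq]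

lemma Isometry.isGeodesicSegment {γ : ℝ → X} (hγ : Isometry γ) {y : X}
    (hy : γ (dist (γ 0) y) = y) : IsGeodesicSegment γ (γ 0) y :=
  ⟨rfl, hy, fun s _ t _ => hγ.dist_eq_abs s t⟩

lemma Isometry.exists_reparametrization {γ : ℝ → X} (hγ : Isometry γ) {x y : X}
    (hx : x ∈ range γ) (hy : y ∈ range γ) :
    ∃ σ : ℝ → X, Isometry σ ∧ σ 0 = x ∧ σ (dist x y) = y ∧ range σ = range γ := by
  obtain ⟨s, rfl⟩ := hx
  obtain ⟨t, rfl⟩ := hy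
  rw [hγ.dist_eq_abs]
  rcases le_total s t with h | h
  · refine ⟨fun u => γ (s + u), hγ.comp (isometry_add_left s), by simp, ?_, ?_⟩
    · rw [abs_sub_comm, abs_of_nonneg (sub_nonneg.2 h)]; simp
    · exact (Equiv.addLeft s).surjective.range_comp γ
  · refine ⟨fun u => γ (s - u), hγ.comp ?_, by simp, ?_, ?_⟩
    · exact Isometry.of_dist_eq fun u v => dist_sub_left s u v
    · rw [abs_of_nonneg (sub_nonneg.2 h)]; simp
    · exact (Equiv.subLeft s).surjective.range_comp γ

lemma exists_line_through (hug : IsUniquelyGeodesic X) (hgc : IsGeodesicallyComplete X)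
    (x y : X) : ∃ γ : ℝ → X, Isometry γ ∧ γ 0 = x ∧ γ (dist x y) = y := by
  obtain ⟨γ, hγ⟩ := (hug x y).1
  obtain ⟨σ, hσ, hsub⟩ := hgc x y γ hγ
  obtain ⟨τ, hτ, h0, h1, -⟩ := hσ.exists_reparametrization
    (hγ.1 ▸ hsub (mem_image_of_mem γ ⟨le_rfl, dist_nonneg⟩) : x ∈ range σ)
    (hγ.2.1 ▸ hsub (mem_image_of_mem γ ⟨dist_nonneg, le_rfl⟩) : y ∈ range σ)
  exact ⟨τ, hτ, h0, h1⟩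

/-- Every segment from `x` to `p` extends beyond `p` by any given length. -/
lemma exists_dist_eq_add (hug : IsUniquelyGeodesic X) (hgc : IsGeodesicallyComplete X)
    (x p : X) {s : ℝ} (hs : 0 ≤ s) : ∃ q, dist p q = s ∧ dist x q = dist x p + s := by
  obtain ⟨γ, hγ, h0, h1⟩ := exists_line_through hug hgc x p
  have hd : 0 ≤ dist x p := dist_nonneg
  refine ⟨γ (dist x p + s), ?_, ?_⟩
  · nth_rewrite 1 [← h1]
    rw [hγ.dist_eq_abs, abs_sub_comm, add_sub_cancel_left, abs_of_nonneg hs]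
  · nth_rewrite 1 [← h0]
    rw [hγ.dist_eq_abs, zero_sub, abs_neg, abs_of_nonneg (by linarith)]

/-- A point lying metrically between the ends of a segment lies on the segment. -/
lemma Isometry.eq_of_dist_add_dist (hug : IsUniquelyGeodesic X) (hgc : IsGeodesicallyComplete X)
    {γ : ℝ → X} (hγ : Isometry γ) {m y : X} (hy : γ (dist (γ 0) y) = y)
    (hm : dist (γ 0) m + dist m y = dist (γ 0) y) : m = γ (dist (γ 0) m) := by
  obtain ⟨σ, hσ, hσ0, hσ1⟩ := exists_line_through hug hgc (γ 0) m
  obtain ⟨τ, hτ, hτ0, hτ1⟩ := exists_line_through hug hgc m y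
  set x := γ 0 with hx
  set a := dist x m
  have ha : 0 ≤ a := dist_nonneg
  have hb : 0 ≤ dist m y := dist_nonneg
  have hmem : a ∈ Icc 0 (dist x y) := ⟨ha, by linarith⟩
  let κ : ℝ → X := fun t => if t ≤ a then σ t else τ (t - a)
  have hκτ : ∀ t, a ≤ t → κ t = τ (t - a) := by
    intro t ht
    rcases ht.eq_or_lt with rfl | ht
    · simp [κ, hσ1, hτ0]
    · simp [κ, not_le.2 ht]
  have hκσ : ∀ t, t ≤ a → κ t = σ t := fun t ht => by simp [κ, ht]
  have mixed : ∀ s t, 0 ≤ s → s ≤ a → a ≤ t → t ≤ dist x y → dist (κ s) (κ t) = t - s := by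
    intro s t h0 hs ht h1
    rw [hκσ s hs, hκτ t ht]
    have e1 : dist x (σ s) = s := by
      rw [← hσ0, hσ.dist_eq_abs, zero_sub, abs_neg, abs_of_nonneg h0]
    have e2 : dist (σ s) m = a - s := by
      rw [← hσ1, hσ.dist_eq_abs, abs_sub_comm, abs_of_nonneg (by linarith)]
    have e3 : dist m (τ (t - a)) = t - a := by
      rw [← hτ0, hτ.dist_eq_abs, zero_sub, abs_neg, abs_of_nonneg (by linarith)]
    have e4 : dist (τ (t - a)) y = dist x y - t := by
      rw [← hτ1, hτ.dist_eq_abs, hτ1, abs_sub_comm, abs_of_nonneg (by linarith)]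
      linarith
    have t1 := dist_triangle (σ s) m (τ (t - a))
    have t2 := dist_triangle4 x (σ s) (τ (t - a)) y
    linarith
  have hκ : IsGeodesicSegment κ x y := by
    refine ⟨by rw [hκσ 0 ha, hσ0], ?_, fun s hs t ht => ?_⟩
    · rw [hκτ _ (by linarith), ← hm, add_sub_cancel_left, hτ1]
    · rcases le_total s a with hsa | hsa <;> rcases le_total t a with hta | hta
      · rw [hκσ s hsa, hκσ t hta, hσ.dist_eq_abs]
      · rw [mixed s t hs.1 hsa hta ht.2, abs_sub_comm, abs_of_nonneg (by linarith)]
      · rw [dist_comm, mixed t s ht.1 hta hsa hs.2, abs_of_nonneg (by linarith)]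
      · rw [hκτ s hsa, hκτ t hta, hτ.dist_eq_abs]
        congr 1; ring
  have := (hug x y).2 κ γ hκ (hγ.isGeodesicSegment hy) a hmem
  rw [← this, hκσ a le_rfl, hσ1]

/-- Two lines sharing two distinct points have the same image. -/
lemma Isometry.range_eq_of_mem (hug : IsUniquelyGeodesic X) (hns : GeodesicsDoNotSplit X)
    {γ σ : ℝ → X} (hγ : Isometry γ) (hσ : Isometry σ) {p q : X} (hpq : p ≠ q)
    (hpγ : p ∈ range γ) (hqγ : q ∈ range γ) (hpσ : p ∈ range σ) (hqσ : q ∈ range σ) :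
    range γ = range σ := by
  obtain ⟨γ', hγ', rfl, h1, hr⟩ := hγ.exists_reparametrization hpγ hqγ
  obtain ⟨σ', hσ', h0', h1', hr'⟩ := hσ.exists_reparametrization hpσ hqσ
  have hsegσ : IsGeodesicSegment σ' (γ' 0) q := by
    rw [← h0'] at h1' ⊢
    exact hσ'.isGeodesicSegment h1'
  have hseg := hγ'.isGeodesicSegment h1
  rw [← hr, ← hr']
  refine hns _ q γ' hseg hpq γ' σ' hγ' hσ' (image_subset_range _ _) ?_
  rintro _ ⟨t, ht, rfl⟩
  exact ⟨t, ((hug _ q).2 _ _ hseg hsegσ t ht).symm⟩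

/-- Lines are determined by two of their values. -/
lemma Isometry.eq_of_eq_of_eq (hug : IsUniquelyGeodesic X) (hns : GeodesicsDoNotSplit X)
    {γ σ : ℝ → X} (hγ : Isometry γ) (hσ : Isometry σ) {s : ℝ} (hs : 0 < s)
    (h0 : γ 0 = σ 0) (h1 : γ s = σ s) : γ = σ := by
  have hr := hγ.range_eq_of_mem hug hns hσ (hγ.injective.ne hs.ne) ⟨0, rfl⟩ ⟨s, rfl⟩
    ⟨0, h0.symm⟩ ⟨s, h1.symm⟩
  funext t
  obtain ⟨u, hu⟩ : γ t ∈ range σ := hr ▸ mem_range_self t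
  have e0 : |t| = |u| := by
    have a := hγ.dist_eq_abs t 0
    have b := hσ.dist_eq_abs u 0
    rw [hu, ← h0] at b
    simpa using a.symm.trans b
  have e1 : |t - s| = |u - s| := by
    have a := hγ.dist_eq_abs t s
    have b := hσ.dist_eq_abs u s
    rw [hu, ← h1] at b
    exact a.symm.trans b
  have e0' := (sq_eq_sq_iff_abs_eq_abs t u).2 e0
  have e1' := (sq_eq_sq_iff_abs_eq_abs _ _).2 e1
  have : s * (t - u) = 0 := by nlinarith
  rcases mul_eq_zero.1 this with h | h
  · exact absurd h hs.ne'
  · rw [← hu, sub_eq_zero.1 h]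

/-- The extension of a nondegenerate segment by a given length is unique. -/
lemma eq_of_dist_eq_add (hug : IsUniquelyGeodesic X) (hgc : IsGeodesicallyComplete X)
    (hns : GeodesicsDoNotSplit X) {x p q q' : X} (hxp : x ≠ p)
    (hq : dist x p + dist p q = dist x q) (hq' : dist x p + dist p q' = dist x q')
    (h : dist p q = dist p q') : q = q' := by
  obtain ⟨γ, hγ, rfl, h1⟩ := exists_line_through hug hgc x q
  obtain ⟨σ, hσ, h0', h1'⟩ := exists_line_through hug hgc (γ 0) q'
  have e := hγ.eq_of_dist_add_dist hug hgc h1 hq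
  have e' : p = σ (dist (γ 0) p) := by
    rw [← h0'] at hq' h1' ⊢
    exact hσ.eq_of_dist_add_dist hug hgc h1' hq'
  have := hγ.eq_of_eq_of_eq hug hns hσ (dist_pos.2 hxp) h0'.symm (e.symm.trans e')
  have hqq : dist (γ 0) q = dist (γ 0) q' := by rw [← hq, ← hq', h]
  rw [← h1, ← h1', hqq, this]

/-- Midpoints are unique. -/
lemma eq_of_dist_le_half (hug : IsUniquelyGeodesic X) (hgc : IsGeodesicallyComplete X)
    {x y m m' : X} {r : ℝ} (hxy : dist x y = 2 * r) (h1 : dist m x ≤ r) (h2 : dist m y ≤ r)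
    (h1' : dist m' x ≤ r) (h2' : dist m' y ≤ r) : m = m' := by
  obtain ⟨γ, hγ, rfl, hy⟩ := exists_line_through hug hgc x y
  have key : ∀ z, dist z (γ 0) ≤ r → dist z y ≤ r → z = γ r := by
    intro z hz hz'
    rw [dist_comm] at hz
    have := dist_triangle (γ 0) z y
    have e : dist (γ 0) z = r := by linarith
    rw [← e]
    exact hγ.eq_of_dist_add_dist hug hgc hy (by linarith)
  rw [key m h1 h2, key m' h1' h2']

end Geodesics

/-! ### Metric properties characterizing singletons -/

section Singletons

variable [MetricSpace X]

/-- Every distance in `𝔉(X,d)` from some `B` to `A` can be prolonged beyond `A`. -/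
def IsExtendable (A : NonemptyCompacts X) : Prop :=
  ∀ (B : NonemptyCompacts X) (s : ℝ), 0 < s → ∃ C, dist A C ≤ s ∧ dist B A + s ≤ dist B C

/-- For every `r > 0`, the set `A` is the only midpoint of some pair at distance `2 * r`. -/
def IsUniqueMidpoint (A : NonemptyCompacts X) : Prop :=
  ∀ r : ℝ, 0 < r → ∃ B C : NonemptyCompacts X, dist B C = 2 * r ∧ dist A B ≤ r ∧ dist A C ≤ r ∧
    ∀ A' : NonemptyCompacts X, dist A' B ≤ r → dist A' C ≤ r → A' = A

lemma IsExtendable.map {A : NonemptyCompacts X} (h : IsExtendable A)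
    (I : NonemptyCompacts X ≃ᵢ NonemptyCompacts X) : IsExtendable (I A) := by
  intro B s hs
  obtain ⟨C, h1, h2⟩ := h (I.symm B) s hs
  refine ⟨I C, by rwa [I.dist_eq], ?_⟩
  rwa [← I.apply_symm_apply B, I.dist_eq, I.dist_eq]

lemma IsUniqueMidpoint.map {A : NonemptyCompacts X} (h : IsUniqueMidpoint A)
    (I : NonemptyCompacts X ≃ᵢ NonemptyCompacts X) : IsUniqueMidpoint (I A) := by
  intro r hr
  obtain ⟨B, C, h1, h2, h3, h4⟩ := h r hr
  refine ⟨I B, I C, by rwa [I.dist_eq], by rwa [I.dist_eq], by rwa [I.dist_eq], fun A' hB hC => ?_⟩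
  rw [← I.apply_symm_apply A', I.dist_eq] at hB hC
  rw [← h4 _ hB hC, I.apply_symm_apply]

lemma isExtendable_singleton (hug : IsUniquelyGeodesic X) (hgc : IsGeodesicallyComplete X)
    (p : X) : IsExtendable ({p} : NonemptyCompacts X) := by
  intro B s hs
  obtain ⟨b, hb, hbp⟩ := exists_dist_singleton_eq B p
  obtain ⟨q, hpq, hbq⟩ := exists_dist_eq_add hug hgc b p hs.le
  refine ⟨{q}, ?_, ?_⟩
  · rw [NonemptyCompacts.isometry_singleton.dist_eq, hpq]
  · rw [dist_comm B, hbp, dist_comm p, ← hbq, dist_comm B, dist_comm b]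
    exact dist_le_dist_singleton hb q

lemma isUniqueMidpoint_singleton (hug : IsUniquelyGeodesic X) (hgc : IsGeodesicallyComplete X)
    (p : X) : IsUniqueMidpoint ({p} : NonemptyCompacts X) := by
  intro r hr
  obtain ⟨x, hx, -⟩ := exists_dist_eq_add hug hgc p p hr.le
  obtain ⟨y, hy, hxy⟩ := exists_dist_eq_add hug hgc x p hr.le
  rw [dist_comm x p, hx] at hxy
  refine ⟨{x}, {y}, ?_, ?_, ?_, fun A' h1 h2 => ?_⟩
  · rw [NonemptyCompacts.isometry_singleton.dist_eq, hxy]; ring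
  · rw [NonemptyCompacts.isometry_singleton.dist_eq, hx]
  · rw [NonemptyCompacts.isometry_singleton.dist_eq, hy]
  · have key : ∀ a ∈ A', a = p := fun a ha => eq_of_dist_le_half hug hgc
      (by rw [hxy]; ring) (dist_comm a x ▸ (dist_le_dist_singleton ha x).trans (dist_comm _ A' ▸ h1))
      (dist_comm a y ▸ (dist_le_dist_singleton ha y).trans (dist_comm _ A' ▸ h2)) hx.le hy.le
    obtain ⟨a, ha⟩ := A'.nonempty
    ext z
    refine ⟨fun hz => key z hz, fun hz => ?_⟩
    rw [show z = p from hz, ← key a ha]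
    exact ha

/-- If `X` is not a line, an extendable set is a singleton. -/
lemma IsExtendable.subsingleton (hug : IsUniquelyGeodesic X) (hgc : IsGeodesicallyComplete X)
    (hns : GeodesicsDoNotSplit X) (hline : ∀ γ : ℝ → X, Isometry γ → range γ ≠ univ)
    {A : NonemptyCompacts X} (hA : IsExtendable A) : (A : Set X).Subsingleton := by
  obtain ⟨⟨a₀, a₁⟩, ⟨ha₀, ha₁⟩, hmax⟩ := (A.isCompact.prod A.isCompact).exists_isMaxOn
    (A.nonempty.prod A.nonempty) (f := fun z : X × X => dist z.1 z.2) (by fun_prop)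
  have hmax : ∀ x ∈ A, ∀ y ∈ A, dist x y ≤ dist a₀ a₁ := fun x hx y hy =>
    isMaxOn_iff.1 hmax (x, y) ⟨hx, hy⟩
  by_contra hne
  have hδ : 0 < dist a₀ a₁ := by
    by_contra! h
    exact hne fun x hx y hy => dist_le_zero.1 ((hmax x hx y hy).trans h)
  obtain ⟨γ, hγ, rfl, h1⟩ := exists_line_through hug hgc a₀ a₁
  obtain ⟨x, hx⟩ : ∃ x, x ∉ range γ := by
    by_contra! h
    exact hline γ hγ (eq_univ_of_forall h)
  set δ := dist (γ 0) a₁ with hδdef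
  obtain ⟨σ, hσ, rfl, hσx⟩ := exists_line_through hug hgc a₁ x
  set y := σ (δ / 4) with hy
  have hy1 : dist (σ 0) y = δ / 4 := by
    rw [hσ.dist_eq_abs, zero_sub, abs_neg, abs_of_pos (by linarith)]
  have hyne : σ 0 ≠ y := hσ.injective.ne (by linarith)
  have hyγ : y ∉ range γ := fun h => hx <| by
    rw [hγ.range_eq_of_mem hug hns hσ hyne ⟨δ, h1⟩ h ⟨0, rfl⟩ ⟨_, rfl⟩]
    exact ⟨_, hσx⟩
  have hy2 : 3 * δ / 4 ≤ dist (γ 0) y := by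
    linarith [dist_triangle_right (γ 0) (σ 0) y]
  have hy3 : dist (γ 0) y ≤ 5 * δ / 4 := by
    linarith [dist_triangle (γ 0) (σ 0) y]
  obtain ⟨τ, hτ, hτ0, hτy⟩ := exists_line_through hug hgc (γ 0) y
  set b := γ (2 * δ) with hb
  set b' := τ (2 * δ) with hb'
  have hbb' : b ≠ b' := fun h => hyγ <| by
    rw [hγ.eq_of_eq_of_eq hug hns hτ (by linarith) hτ0.symm h]
    exact ⟨_, hτy⟩
  have d0b : dist (γ 0) b = 2 * δ := by
    rw [hγ.dist_eq_abs, zero_sub, abs_neg, abs_of_pos (by linarith)]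
  have d0b' : dist (γ 0) b' = 2 * δ := by
    rw [← hτ0, hτ.dist_eq_abs, zero_sub, abs_neg, abs_of_pos (by linarith)]
  have d1b : dist b (σ 0) = δ := by
    rw [← h1, hγ.dist_eq_abs, abs_of_pos (by linarith)]; ring
  have d1b' : dist b' (σ 0) < 2 * δ := by
    have e : dist b' y = 2 * δ - dist (γ 0) y := by
      nth_rewrite 1 [← hτy]
      rw [hτ.dist_eq_abs, abs_of_nonneg (by linarith)]
    linarith [dist_triangle_right b' (σ 0) y]
  have hB : ∀ z ∈ ({b} ⊔ {b'} : NonemptyCompacts X), z = b ∨ z = b' := fun z hz => hz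
  have hbB : b ∈ ({b} ⊔ {b'} : NonemptyCompacts X) := Or.inl rfl
  have hb'B : b' ∈ ({b} ⊔ {b'} : NonemptyCompacts X) := Or.inr rfl
  have hfar : 2 * δ ≤ dist ({b} ⊔ {b'}) A := by
    obtain ⟨z, hz, h⟩ := exists_dist_le_dist_nonemptyCompacts ({b} ⊔ {b'}) ha₀
    rw [dist_comm _ A]
    rcases hB z hz with rfl | rfl
    · exact d0b ▸ h
    · exact d0b' ▸ h
  have hnear : ∀ a ∈ A, dist a b ≤ 2 * δ := fun a ha => by
    linarith [dist_triangle_right a b (σ 0), hmax a ha _ ha₁]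
  obtain ⟨C, hAC, hBC⟩ := hA ({b} ⊔ {b'}) 1 one_pos
  rcases dist_nonemptyCompacts_attained ({b} ⊔ {b'}) C with ⟨z, hz, h⟩ | ⟨c, hc, h⟩
  · obtain ⟨c, hc, hc1⟩ := exists_dist_le_dist_nonemptyCompacts C ha₁
    have := h c hc
    have t := dist_triangle z (σ 0) c
    rcases hB z hz with rfl | rfl <;> linarith
  · obtain ⟨a, ha, hca⟩ := exists_dist_le_dist_nonemptyCompacts A hc
    rw [dist_comm] at hAC
    have hcb := h b hbB
    have hcb' := h b' hb'B
    have t := dist_triangle c a b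
    have n := hnear a ha
    have t1 := dist_triangle_right a b (σ 0)
    have hm := hmax a ha _ ha₁
    have ea : a = γ 0 := by
      refine eq_of_dist_eq_add hug hgc hns (x := b) (p := σ 0) ?_ ?_ ?_ ?_
      · exact dist_pos.1 (by linarith)
      · rw [dist_comm (σ 0), dist_comm b a]; linarith
      · rw [dist_comm (σ 0), dist_comm b (γ 0)]; linarith
      · rw [dist_comm (σ 0), dist_comm (σ 0)]; linarith
    rw [ea] at hca t
    have t' := dist_triangle c (γ 0) b'
    refine hbb' (eq_of_dist_eq_add hug hgc hns (x := c) (p := γ 0) ?_ ?_ ?_ ?_)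
    · exact dist_pos.1 (by linarith)
    all_goals linarith

/-- Auxiliary form of `IsUniqueMidpoint.subsingleton`, for a coordinate in which the points
`b`, `a₀`, `c₀` are aligned in this order. -/
lemma subsingleton_of_unique_midpoint {f : X → ℝ} (hf : Isometry f)
    (hfs : Function.Surjective f) {A B C : NonemptyCompacts X} {r : ℝ}
    (hr : ∀ a ∈ A, ∀ a' ∈ A, dist a a' < r) (hAB : dist A B ≤ r) (hAC : dist A C ≤ r)
    (huniq : ∀ A' : NonemptyCompacts X, dist A' B ≤ r → dist A' C ≤ r → A' = A)
    {b a₀ c₀ : X} (hb : ∀ c ∈ C, 2 * r ≤ dist b c) (ha₀ : a₀ ∈ A) (hc₀ : c₀ ∈ C)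
    (hba : f b = f a₀ - r) (hca : f c₀ = f a₀ + r) : (A : Set X).Subsingleton := by
  have hd : ∀ x y, dist x y = |f x - f y| := fun x y => by rw [← hf.dist_eq, Real.dist_eq]
  have hr0 : 0 < r := (dist_self a₀).symm.trans_lt (hr a₀ ha₀ a₀ ha₀)
  obtain ⟨a₁, ha₁, hmax⟩ := A.isCompact.exists_isMaxOn A.nonempty hf.continuous.continuousOn
  have hmax : ∀ a ∈ A, f a ≤ f a₁ := fun a ha => hmax ha
  have hA0 : ∀ a ∈ A, f a₀ ≤ f a := by
    intro a ha
    obtain ⟨c, hc, hac⟩ := exists_dist_le_dist_nonemptyCompacts C ha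
    have h1 := hb c hc
    have h2 := hr a ha a₀ ha₀
    have h3 := hac.trans hAC
    rw [hd, abs_le] at h3
    rw [hd, abs_lt] at h2
    rw [hd, le_abs] at h1
    rcases h1 with h1 | h1 <;> linarith
  have h01 : f a₁ - f a₀ < r := by
    have := hr a₁ ha₁ a₀ ha₀
    rw [hd, abs_lt] at this
    exact this.2
  have mid : ∀ D : NonemptyCompacts X, dist A D ≤ r → dist ({a₀} ⊔ {a₁}) D ≤ r := by
    intro D hD
    refine dist_nonemptyCompacts_le hr0.le ?_ fun y hy => ?_
    · rintro a (rfl | rfl)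
      · obtain ⟨y, hy, h⟩ := exists_dist_le_dist_nonemptyCompacts D ha₀
        exact ⟨y, hy, h.trans hD⟩
      · obtain ⟨y, hy, h⟩ := exists_dist_le_dist_nonemptyCompacts D ha₁
        exact ⟨y, hy, h.trans hD⟩
    · obtain ⟨a, ha, h⟩ := exists_dist_le_dist_nonemptyCompacts A hy
      rw [dist_comm D] at h
      have h := h.trans hD
      rw [hd, abs_le] at h
      have := hA0 a ha
      have := hmax a ha
      rcases le_total (f y) (f a₀ + r) with h' | h'
      · exact ⟨a₀, Or.inl rfl, by rw [hd, abs_le]; constructor <;> linarith⟩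
      · exact ⟨a₁, Or.inr rfl, by rw [hd, abs_le]; constructor <;> linarith⟩
  have hpair := huniq _ (mid B hAB) (mid C hAC)
  have hA : ∀ a ∈ A, a = a₀ ∨ a = a₁ := fun a ha => by
    rw [← hpair] at ha; exact ha
  suffices f a₁ ≤ f a₀ by
    have e : a₁ = a₀ := hf.injective (le_antisymm this (hmax a₀ ha₀))
    intro x hx y hy
    have hx := hA x hx
    have hy := hA y hy
    rw [e, or_self] at hx hy
    rw [hx, hy]
  by_contra! hlt
  have add : ∀ x, (∃ y ∈ B, dist x y ≤ r) → (∃ y ∈ C, dist x y ≤ r) → x ∈ A := by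
    intro x hxB hxC
    have aux : ∀ D : NonemptyCompacts X, dist A D ≤ r → (∃ y ∈ D, dist x y ≤ r) →
        dist (A ⊔ {x}) D ≤ r := by
      intro D hD hxD
      refine dist_nonemptyCompacts_le hr0.le ?_ fun y hy => ?_
      · rintro a (ha | rfl)
        · obtain ⟨y, hy, h⟩ := exists_dist_le_dist_nonemptyCompacts D ha
          exact ⟨y, hy, h.trans hD⟩
        · exact hxD
      · obtain ⟨a, ha, h⟩ := exists_dist_le_dist_nonemptyCompacts A hy
        exact ⟨a, Or.inl ha, h.trans (dist_comm A D ▸ hD)⟩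
    rw [← huniq _ (aux B hAB hxB) (aux C hAC hxC)]
    exact Or.inr rfl
  obtain ⟨β, hβ, hβ1⟩ := exists_dist_le_dist_nonemptyCompacts B ha₁
  have hβ1 := hβ1.trans hAB
  rw [hd, abs_le] at hβ1
  have key : ∀ t, f a₀ ≤ t → t ≤ f a₀ + 2 * r → f β - r ≤ t → t ≤ f β + r → t = f a₀ ∨ t = f a₁ := by
    intro t h1 h2 h3 h4
    obtain ⟨x, rfl⟩ := hfs t
    refine (hA x (add x ⟨β, hβ, ?_⟩ ⟨c₀, hc₀, ?_⟩)).imp (congrArg f) (congrArg f)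
    · rw [hd, abs_le]; constructor <;> linarith
    · rw [hd, abs_le]; constructor <;> linarith
  rcases hβ1.2.eq_or_lt with h | h
  · rcases key ((f a₀ + f a₁) / 2) (by linarith) (by linarith) (by linarith) (by linarith)
      with h | h <;> linarith
  · rcases key (min (f a₀ + 2 * r) (f β + r)) (le_min (by linarith) (by linarith))
      (min_le_left _ _) (le_min (by linarith) (by linarith)) (min_le_right _ _) with h' | h' <;>
    rcases min_choice (f a₀ + 2 * r) (f β + r) with h'' | h'' <;> linarith

/-- If `X` is a line, a set which is a unique midpoint at all scales is a singleton. -/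
lemma IsUniqueMidpoint.subsingleton {f : X → ℝ} (hf : Isometry f) (hfs : Function.Surjective f)
    {A : NonemptyCompacts X} (hA : IsUniqueMidpoint A) : (A : Set X).Subsingleton := by
  obtain ⟨⟨x, y⟩, -, hmax⟩ := (A.isCompact.prod A.isCompact).exists_isMaxOn
    (A.nonempty.prod A.nonempty) (f := fun z : X × X => dist z.1 z.2) (by fun_prop)
  have hr : ∀ a ∈ A, ∀ a' ∈ A, dist a a' < dist x y + 1 :=
    fun a ha a' ha' => (isMaxOn_iff.1 hmax (a, a') ⟨ha, ha'⟩).trans_lt (lt_add_one _)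
  generalize dist x y + 1 = r at hr
  obtain ⟨a, ha⟩ := A.nonempty
  have hr0 : 0 < r := (dist_self a).symm.trans_lt (hr a ha a ha)
  obtain ⟨B, C, hBC, hAB, hAC, huniq⟩ := hA r hr0
  have main : ∀ B C : NonemptyCompacts X, dist A B ≤ r → dist A C ≤ r →
      (∀ A' : NonemptyCompacts X, dist A' B ≤ r → dist A' C ≤ r → A' = A) →
      (∃ b ∈ B, ∀ c ∈ C, 2 * r ≤ dist b c) → (A : Set X).Subsingleton := by
    rintro B C hAB hAC huniq ⟨b, hb, hbC⟩
    obtain ⟨a, ha, hba⟩ := exists_dist_le_dist_nonemptyCompacts A hb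
    obtain ⟨c, hc, hac⟩ := exists_dist_le_dist_nonemptyCompacts C ha
    have h1 := hba.trans (dist_comm A B ▸ hAB)
    have h2 := hac.trans hAC
    have h3 := hbC c hc
    have hd : ∀ x y, dist x y = |f x - f y| := fun x y => by rw [← hf.dist_eq, Real.dist_eq]
    rw [hd, abs_le] at h1 h2
    rw [hd, le_abs] at h3
    rcases h3 with h3 | h3
    · have hf' : Isometry fun z => -f z := Isometry.of_dist_eq fun u v => by
        rw [dist_neg_neg, hf.dist_eq]
      have hfs' : Function.Surjective fun z => -f z := (Equiv.neg ℝ).surjective.comp hfs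
      exact subsingleton_of_unique_midpoint hf' hfs' hr hAB hAC huniq hbC ha hc
        (by linarith) (by linarith)
    · exact subsingleton_of_unique_midpoint hf hfs hr hAB hAC huniq hbC ha hc
        (by linarith) (by linarith)
  rcases dist_nonemptyCompacts_attained B C with h | h
  · exact main B C hAB hAC huniq (hBC ▸ h)
  · exact main C B hAC hAB (fun A' hC hB => huniq A' hB hC) (hBC ▸ h)

lemma exists_eq_singleton (hug : IsUniquelyGeodesic X) (hgc : IsGeodesicallyComplete X)
    (hns : GeodesicsDoNotSplit X) {A : NonemptyCompacts X} (h1 : IsExtendable A)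
    (h2 : IsUniqueMidpoint A) : ∃ p, A = {p} := by
  have : (A : Set X).Subsingleton := by
    by_cases hline : ∃ γ : ℝ → X, Isometry γ ∧ range γ = univ
    · obtain ⟨γ, hγ, hr⟩ := hline
      have hinv := Function.rightInverse_surjInv (range_eq_univ.1 hr)
      refine h2.subsingleton (f := Function.surjInv (range_eq_univ.1 hr))
        (hγ.right_inv hinv) fun t => ⟨γ t, hγ.injective (hinv _)⟩
    · push Not at hline
      exact h1.subsingleton hug hgc hns hline
  obtain ⟨p, hp⟩ := A.nonempty
  exact ⟨p, NonemptyCompacts.ext (this.eq_singleton_of_mem hp)⟩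

/-- A surjective isometry of `𝔉(X,d)` maps singletons to singletons. -/
lemma exists_map_singleton_eq (hug : IsUniquelyGeodesic X) (hgc : IsGeodesicallyComplete X)
    (hns : GeodesicsDoNotSplit X) (I : NonemptyCompacts X ≃ᵢ NonemptyCompacts X) (p : X) :
    ∃ q, I {p} = {q} :=
  exists_eq_singleton hug hgc hns ((isExtendable_singleton hug hgc p).map I)
    ((isUniqueMidpoint_singleton hug hgc p).map I)

end Singletons

/-! ### Isometries fixing all singletons -/

section FixingSingletons

variable [MetricSpace X]

/-- Midpoints between `{p}` and a subset of a sphere centred at `p` are unique. -/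
lemma unique_midpoint_of_dist_eq (hug : IsUniquelyGeodesic X) (hgc : IsGeodesicallyComplete X)
    {p : X} {ρ : ℝ} {D M M' : NonemptyCompacts X} (hD : ∀ q ∈ D, dist p q = ρ)
    (h1 : dist {p} M ≤ ρ / 2) (h2 : dist M D ≤ ρ / 2)
    (h1' : dist {p} M' ≤ ρ / 2) (h2' : dist M' D ≤ ρ / 2) : M = M' := by
  have sub : ∀ M M' : NonemptyCompacts X, dist {p} M ≤ ρ / 2 → dist M D ≤ ρ / 2 →
      dist {p} M' ≤ ρ / 2 → dist M' D ≤ ρ / 2 → ∀ m ∈ M, m ∈ M' := by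
    intro M M' h1 h2 h1' h2' m hm
    obtain ⟨q, hq, hmq⟩ := exists_dist_le_dist_nonemptyCompacts D hm
    obtain ⟨m', hm', hqm'⟩ := exists_dist_le_dist_nonemptyCompacts M' hq
    rw [dist_comm q, dist_comm D] at hqm'
    rw [eq_of_dist_le_half hug hgc (x := p) (y := q) (r := ρ / 2) (by rw [hD q hq]; ring)
      (dist_comm p m ▸ (dist_le_dist_singleton hm p).trans h1) (hmq.trans h2)
      (dist_comm p m' ▸ (dist_le_dist_singleton hm' p).trans h1') (hqm'.trans h2')]
    exact hm'
  exact NonemptyCompacts.ext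
    (Subset.antisymm (sub M M' h1 h2 h1' h2') (sub M' M h1' h2' h1 h2))

/-- On a geodesic line through `p` and `e` there is a point at prescribed distance from `p`. -/
lemma exists_dist_eq_dist_le (hug : IsUniquelyGeodesic X) (hgc : IsGeodesicallyComplete X)
    (p e : X) {t r : ℝ} (ht : 0 ≤ t) (hte : |t - dist p e| ≤ r) :
    ∃ z, dist p z = t ∧ dist z e ≤ r := by
  obtain ⟨γ, hγ, h0, h1⟩ := exists_line_through hug hgc p e
  have hp := hγ.dist_eq_abs 0 t
  have he := hγ.dist_eq_abs t (dist p e)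
  rw [h0, zero_sub, abs_neg, abs_of_nonneg ht] at hp
  rw [h1] at he
  exact ⟨γ t, hp, he ▸ hte⟩

lemma infDist_le_iff_exists_dist_le (E : NonemptyCompacts X) {z : X} {r : ℝ} :
    infDist z E ≤ r ↔ ∃ e ∈ E, dist z e ≤ r := by
  refine ⟨fun h => ?_, fun ⟨e, he, h⟩ => (infDist_le_dist_of_mem he).trans h⟩
  obtain ⟨e, he, hze⟩ := E.isCompact.exists_infDist_eq_dist E.nonempty z
  exact ⟨e, he, hze ▸ h⟩

variable {J : NonemptyCompacts X ≃ᵢ NonemptyCompacts X}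

lemma symm_singleton_eq (hJ : ∀ p : X, J {p} = {p}) (p : X) : J.symm {p} = {p} := by
  rw [J.symm_apply_eq, hJ]

lemma dist_singleton_map (hJ : ∀ p : X, J {p} = {p}) (p : X) (A : NonemptyCompacts X) :
    dist {p} (J A) = dist {p} A := by
  nth_rewrite 1 [← hJ p]
  exact J.dist_eq _ _

variable [ProperSpace X]

/-- Midpoints between `{p}` and `E` with prescribed distances to `p`. -/
lemma exists_midpoint_dist_mem (hug : IsUniquelyGeodesic X) (hgc : IsGeodesicallyComplete X)
    {p : X} {ρ : ℝ} {E : NonemptyCompacts X} (hE : ∀ e ∈ E, dist p e ≤ ρ)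
    {T : Set ℝ} (hT : IsClosed T) (hmem : ρ / 2 ∈ T) (hsub : T ⊆ Iic (ρ / 2)) :
    ∃ M : NonemptyCompacts X, dist {p} M ≤ ρ / 2 ∧ dist M E ≤ ρ / 2 ∧
      ∀ z, z ∈ M ↔ dist p z ∈ T ∧ ∃ e ∈ E, dist z e ≤ ρ / 2 := by
  obtain ⟨e₀, he₀⟩ := E.nonempty
  have hρ : 0 ≤ ρ / 2 := div_nonneg (dist_nonneg.trans (hE e₀ he₀)) zero_le_two
  have sphere : ∀ e ∈ E, ∃ z, dist p z = ρ / 2 ∧ dist z e ≤ ρ / 2 := fun e he =>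
    exists_dist_eq_dist_le hug hgc p e hρ (abs_le.2
      ⟨by linarith [hE e he], by linarith [dist_nonneg (x := p) (y := e)]⟩)
  obtain ⟨z₀, hz₀, hz₀'⟩ := sphere e₀ he₀
  obtain ⟨M, hM⟩ := exists_nonemptyCompacts_coe_eq
    (S := {z | dist p z ∈ T} ∩ {z | infDist z E ≤ ρ / 2}) (p := p) (r := ρ / 2)
    ((hT.preimage (by fun_prop)).inter
      (isClosed_le (continuous_infDist_pt _) continuous_const)) (fun x hx => hsub hx.1)
    ⟨z₀, by rwa [mem_ofPred_eq, hz₀], (infDist_le_iff_exists_dist_le E).2 ⟨e₀, he₀, hz₀'⟩⟩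
  have hM' : ∀ z, z ∈ M ↔ dist p z ∈ T ∧ ∃ e ∈ E, dist z e ≤ ρ / 2 := fun z => by
    rw [hM, mem_inter_iff, mem_ofPred_eq, mem_ofPred_eq, infDist_le_iff_exists_dist_le]
  refine ⟨M, dist_singleton_le fun z hz => hsub ((hM' z).1 hz).1,
    dist_nonemptyCompacts_le hρ (fun z hz => ((hM' z).1 hz).2) fun e he => ?_, hM'⟩
  obtain ⟨z, hz, hze⟩ := sphere e he
  exact ⟨z, (hM' z).2 ⟨by rwa [hz], e, he, hze⟩, dist_comm z e ▸ hze⟩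

/-- A set with a unique midpoint with `{p}` is contained in a sphere centred at `p`. -/
lemma dist_eq_of_unique_midpoint (hug : IsUniquelyGeodesic X) (hgc : IsGeodesicallyComplete X)
    {p : X} {ρ : ℝ} {E : NonemptyCompacts X} (hE : ∀ e ∈ E, dist p e ≤ ρ)
    (huniq : ∀ M M' : NonemptyCompacts X, dist {p} M ≤ ρ / 2 → dist M E ≤ ρ / 2 →
      dist {p} M' ≤ ρ / 2 → dist M' E ≤ ρ / 2 → M = M') :
    ∀ e ∈ E, dist p e = ρ := by
  obtain ⟨M, h1, h2, hM⟩ :=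
    exists_midpoint_dist_mem hug hgc hE isClosed_Iic self_mem_Iic subset_rfl
  obtain ⟨M', h1', h2', hM'⟩ := exists_midpoint_dist_mem hug hgc hE (T := {ρ / 2})
    isClosed_singleton (mem_singleton _) (singleton_subset_iff.2 self_mem_Iic)
  intro e he
  have hpe := hE e he
  have hpe0 : 0 ≤ dist p e := dist_nonneg
  obtain ⟨z, hz, hze⟩ := exists_dist_eq_dist_le hug hgc p e (t := dist p e / 2) (r := ρ / 2)
    (by positivity) (abs_le.2 ⟨by linarith, by linarith⟩)
  have hzM : z ∈ M := (hM z).2 ⟨by rw [mem_Iic, hz]; linarith, e, he, hze⟩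
  rw [huniq M M' h1 h2 h1' h2'] at hzM
  have : dist p z = ρ / 2 := mem_singleton_iff.1 ((hM' z).1 hzM).1
  linarith

lemma dist_eq_of_mem_map (hug : IsUniquelyGeodesic X) (hgc : IsGeodesicallyComplete X)
    (hJ : ∀ p : X, J {p} = {p}) {p : X} {ρ : ℝ} {D : NonemptyCompacts X}
    (hD : ∀ q ∈ D, dist p q = ρ) : ∀ q ∈ J D, dist p q = ρ := by
  refine dist_eq_of_unique_midpoint hug hgc (fun e he => ?_) fun M M' h1 h2 h1' h2' => ?_
  · refine (dist_le_dist_singleton he p).trans ?_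
    rw [dist_singleton_map hJ]
    exact dist_singleton_le fun q hq => (hD q hq).le
  · have hs := symm_singleton_eq hJ
    apply J.symm.injective
    refine unique_midpoint_of_dist_eq hug hgc hD ?_ ?_ ?_ ?_
    · rwa [dist_singleton_map hs]
    · rwa [← J.dist_eq, J.apply_symm_apply]
    · rwa [dist_singleton_map hs]
    · rwa [← J.dist_eq, J.apply_symm_apply]

/-- An isometry fixing all singletons fixes all subsets of spheres. -/
lemma map_eq_of_dist_eq (hug : IsUniquelyGeodesic X) (hgc : IsGeodesicallyComplete X)
    (hns : GeodesicsDoNotSplit X) (hJ : ∀ p : X, J {p} = {p}) {p : X} {ρ : ℝ} (hρ : 0 < ρ)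
    {D : NonemptyCompacts X} (hD : ∀ q ∈ D, dist p q = ρ) : J D = D := by
  have sub : ∀ J : NonemptyCompacts X ≃ᵢ NonemptyCompacts X, (∀ p : X, J {p} = {p}) →
      ∀ D : NonemptyCompacts X, (∀ q ∈ D, dist p q = ρ) → ∀ q ∈ D, q ∈ J D := by
    intro J hJ D hD q hq
    obtain ⟨x, hx, hqx⟩ := exists_dist_eq_add hug hgc q p hρ.le
    rw [dist_comm q p, hD q hq] at hqx
    obtain ⟨y, hy, hxy⟩ := exists_dist_singleton_eq (J D) x
    have hpy := dist_eq_of_mem_map hug hgc hJ hD y hy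
    have h := dist_le_dist_singleton hq x
    rw [← dist_singleton_map hJ, hxy, dist_comm x q, hqx] at h
    have t := dist_triangle x p y
    rw [dist_comm x p] at t
    rw [eq_of_dist_eq_add hug hgc hns (x := x) (p := p) (q := q) (q' := y)
      (by rw [ne_comm, ← dist_pos, hx]; exact hρ) ?_ ?_ ?_]
    · exact hy
    · rw [dist_comm x p, dist_comm x q, hx, hD q hq, hqx]
    · rw [dist_comm x p]; linarith
    · rw [hD q hq, hpy]
  refine NonemptyCompacts.ext (Subset.antisymm (fun q hq => ?_) (sub J hJ D hD))
  have := sub J.symm (symm_singleton_eq hJ) (J D) (dist_eq_of_mem_map hug hgc hJ hD) q hq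
  rwa [J.symm_apply_apply] at this

lemma mem_map_of_mem (hug : IsUniquelyGeodesic X) (hgc : IsGeodesicallyComplete X)
    (hns : GeodesicsDoNotSplit X) (hJ : ∀ p : X, J {p} = {p}) {C : NonemptyCompacts X} {p : X}
    (hp : p ∈ C) : p ∈ J C := by
  by_contra hpC
  obtain ⟨x₀, hx₀, hx₀d⟩ := (J C).isCompact.exists_infDist_eq_dist (J C).nonempty p
  set η := infDist p (J C : Set X)
  have hη : 0 < η := hx₀d ▸ dist_pos.2 fun h => hpC (h ▸ hx₀)
  set ρ := dist {p} (J C) + 1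
  have hρ : ∀ x ∈ J C, dist p x < ρ := fun x hx =>
    (dist_le_dist_singleton hx p).trans_lt (lt_add_one _)
  have hηx : ∀ x ∈ J C, η ≤ dist p x := fun x hx => infDist_le_dist_of_mem hx
  have hηρ : η < ρ := hx₀d ▸ hρ x₀ hx₀
  have point : ∀ x ∈ J C, ∃ b, dist p b = ρ ∧ dist b x ≤ ρ - η := by
    intro x hx
    obtain ⟨b, hxb, hpb⟩ := exists_dist_eq_add hug hgc p x (sub_nonneg.2 (hρ x hx).le)
    exact ⟨b, by linarith, by rw [dist_comm]; linarith [hηx x hx]⟩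
  obtain ⟨b₀, hb₀, hb₀'⟩ := point x₀ hx₀
  obtain ⟨B, hB⟩ := exists_nonemptyCompacts_coe_eq
    (S := {b | dist p b = ρ} ∩ {b | infDist b (J C : Set X) ≤ ρ - η}) (p := p) (r := ρ)
    ((isClosed_eq (by fun_prop) continuous_const).inter
      (isClosed_le (continuous_infDist_pt _) continuous_const))
    (fun x hx => hx.1.le) ⟨b₀, hb₀, (infDist_le_dist_of_mem hx₀).trans hb₀'⟩
  have hle : dist B (J C) ≤ ρ - η := by
    refine dist_nonemptyCompacts_le (by linarith) (fun b hb => ?_) fun x hx => ?_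
    · exact (infDist_le_iff_exists_dist_le (J C)).1 ((hB b).1 hb).2
    · obtain ⟨b, hb, hbx⟩ := point x hx
      exact ⟨b, (hB b).2 ⟨hb, (infDist_le_dist_of_mem hx).trans hbx⟩, dist_comm b x ▸ hbx⟩
  rw [← map_eq_of_dist_eq hug hgc hns hJ (hη.trans hηρ) fun b hb => ((hB b).1 hb).1,
    J.dist_eq] at hle
  obtain ⟨b, hb, hpb⟩ := exists_dist_le_dist_nonemptyCompacts B hp
  rw [((hB b).1 hb).1, dist_comm C] at hpb
  linarith

/-- An isometry of `𝔉(X,d)` fixing all singletons is the identity. -/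
lemma map_eq_self (hug : IsUniquelyGeodesic X) (hgc : IsGeodesicallyComplete X)
    (hns : GeodesicsDoNotSplit X) (hJ : ∀ p : X, J {p} = {p}) (C : NonemptyCompacts X) :
    J C = C := by
  refine NonemptyCompacts.ext (Subset.antisymm (fun p hp => ?_)
    fun p hp => mem_map_of_mem hug hgc hns hJ hp)
  have := mem_map_of_mem hug hgc hns (symm_singleton_eq hJ) hp
  rwa [J.symm_apply_apply] at this

end FixingSingletons

/-- The isometry of `𝔉(X,d)` induced by an isometry of `X`. -/
noncomputable def nonemptyCompactsMapIsometryEquiv [MetricSpace X] (i : X ≃ᵢ X) :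
    NonemptyCompacts X ≃ᵢ NonemptyCompacts X :=
  IsometryEquiv.mk' (NonemptyCompacts.map i i.continuous)
    (NonemptyCompacts.map i.symm i.symm.continuous)
    (fun C => NonemptyCompacts.ext (by simp [image_image]))
    (Isometry.of_dist_eq fun A B => by
      simp only [Metric.NonemptyCompacts.dist_eq, NonemptyCompacts.coe_map]
      exact hausdorffDist_image i.isometry)

/-- **Theorem 1.2.** Every surjective isometry of the space of nonempty compact
subsets of a proper, uniquely geodesic, geodesically complete metric space in which
geodesics do not split is induced by an isometry of the underlying space. -/
theorem isometry_of_nonemptyCompacts_induced [MetricSpace X] [ProperSpace X]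
    (hug : IsUniquelyGeodesic X) (hgc : IsGeodesicallyComplete X)
    (hns : GeodesicsDoNotSplit X)
    (I : NonemptyCompacts X ≃ᵢ NonemptyCompacts X) :
    ∃ i : X ≃ᵢ X, ∀ C : NonemptyCompacts X, ((I C) : Set X) = i '' (C : Set X) := by
  choose f hf using exists_map_singleton_eq hug hgc hns I
  choose g hg using exists_map_singleton_eq hug hgc hns I.symm
  have hfi : Isometry f := Isometry.of_dist_eq fun x y => by
    rw [← NonemptyCompacts.isometry_singleton.dist_eq, ← hf, ← hf, I.dist_eq,
      NonemptyCompacts.isometry_singleton.dist_eq]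
  have hfg : ∀ x, f (g x) = x := fun x => by
    rw [← NonemptyCompacts.singleton_inj, ← hf, ← hg, I.apply_symm_apply]
  let i : X ≃ᵢ X := IsometryEquiv.mk' f g hfg hfi
  let K := nonemptyCompactsMapIsometryEquiv i
  have hK : ∀ p : X, K {p} = {f p} := NonemptyCompacts.map_singleton i.continuous
  refine ⟨i, fun C => ?_⟩
  have h := map_eq_self (J := I.trans K.symm) hug hgc hns
    (fun p => by rw [IsometryEquiv.trans_apply, hf, K.symm_apply_eq, hK]) C
  rw [IsometryEquiv.trans_apply, K.symm_apply_eq] at h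
  rw [h]
  rfl
end

section
/- Let (X,d) be a proper, uniquely geodesic, geodesically complete metric space in which geodesics do not split, and assume the unique midpoint map of (X,d) (assigning to x,y the midpoint of the unique geodesic from x to y) is convex. Let I be a surjective isometry of the space C(X,d) of nonempty convex compact subsets of X endowed with the Hausdorff metric d_H. Then I({p}) is a singleton for every p ∈ X. -/
open Metric Set TopologicalSpace

variable {X : Type*}

/-- Two consecutive geodesic segments whose lengths add up to the distance of the outer endpoints
lie on a common geodesic line. -/
lemma exists_line_of_dist_add [MetricSpace X] (hgc : IsGeodesicallyComplete X)
    {q b x : X} {γ₁ γ₂ : ℝ → X} (h₁ : IsGeodesicSegment γ₁ q b) (h₂ : IsGeodesicSegment γ₂ b x)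
    (h : dist q x = dist q b + dist b x) :
    ∃ L : ℝ → X, Isometry L ∧ γ₁ '' Icc 0 (dist q b) ⊆ range L ∧ x ∈ range L := by
  have hqb : (0 : ℝ) ≤ dist q b := dist_nonneg
  have hbx : (0 : ℝ) ≤ dist b x := dist_nonneg
  obtain ⟨h10, h11, h12⟩ := h₁
  obtain ⟨h20, h21, h22⟩ := h₂
  let γ : ℝ → X := fun t => if t ≤ dist q b then γ₁ t else γ₂ (t - dist q b)
  have hleft : ∀ t, t ≤ dist q b → γ t = γ₁ t := fun t ht => if_pos ht
  have hright : ∀ t, dist q b ≤ t → γ t = γ₂ (t - dist q b) := by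
    intro t ht
    rcases ht.eq_or_lt with rfl | ht
    · rw [hleft _ le_rfl, sub_self, h11, h20]
    · exact if_neg ht.not_ge
  have hend : γ (dist q x) = x := by
    rw [hright _ (by linarith), h, add_sub_cancel_left, h21]
  have key : ∀ s ∈ Icc (0 : ℝ) (dist q x), ∀ t ∈ Icc (0 : ℝ) (dist q x), s ≤ t →
      dist (γ s) (γ t) = |s - t| := by
    rintro s ⟨hs0, hs1⟩ t ⟨ht0, ht1⟩ hst
    rcases le_total t (dist q b) with ht | ht
    · rw [hleft s (hst.trans ht), hleft t ht]
      exact h12 s ⟨hs0, hst.trans ht⟩ t ⟨ht0, ht⟩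
    rcases le_total (dist q b) s with hs | hs
    · rw [hright s hs, hright t ht, h22 _ ⟨by linarith, by linarith⟩ _ ⟨by linarith, by linarith⟩]
      congr 1
      ring
    rw [hleft s hs, hright t ht, abs_of_nonpos (by linarith)]
    have e1 := h12 0 ⟨le_rfl, hqb⟩ s ⟨hs0, hs⟩
    have e2 := h12 s ⟨hs0, hs⟩ _ ⟨hqb, le_rfl⟩
    have e3 := h22 0 ⟨le_rfl, hbx⟩ (t - dist q b) ⟨by linarith, by linarith⟩
    have e4 := h22 (t - dist q b) ⟨by linarith, by linarith⟩ _ ⟨hbx, le_rfl⟩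
    rw [h10, abs_of_nonpos (by linarith)] at e1
    rw [h11, abs_of_nonpos (by linarith)] at e2
    rw [h20, abs_of_nonpos (by linarith)] at e3
    rw [h21, abs_of_nonpos (by linarith)] at e4
    have t1 := dist_triangle (γ₁ s) b (γ₂ (t - dist q b))
    have t2 := dist_triangle4 q (γ₁ s) (γ₂ (t - dist q b)) x
    linarith
  have hγ : IsGeodesicSegment γ q x := by
    refine ⟨by rw [hleft 0 hqb, h10], hend, fun s hs t ht => ?_⟩
    rcases le_total s t with hst | hst
    · exact key s hs t ht hst
    · rw [dist_comm, abs_sub_comm]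
      exact key t ht s hs hst
  obtain ⟨L, hL, hsub⟩ := hgc q x γ hγ
  refine ⟨L, hL, ?_, hsub ⟨_, ⟨dist_nonneg, le_rfl⟩, hend⟩⟩
  rintro _ ⟨t, ht, rfl⟩
  exact hsub ⟨t, ⟨ht.1, by linarith [ht.2]⟩, hleft t ht.2⟩

/-- Extensions of a nondegenerate segment by a given length are unique. -/
lemma extension_unique [MetricSpace X] (hug : IsUniquelyGeodesic X)
    (hgc : IsGeodesicallyComplete X) (hns : GeodesicsDoNotSplit X) {q b x y : X} (hqb : q ≠ b)
    (hx : dist q x = dist q b + dist b x) (hy : dist q y = dist q b + dist b y)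
    (hxy : dist b x = dist b y) : x = y := by
  obtain ⟨γ, hγ⟩ := (hug q b).1
  obtain ⟨γx, hγx⟩ := (hug b x).1
  obtain ⟨γy, hγy⟩ := (hug b y).1
  obtain ⟨L, hL, hLγ, u, rfl⟩ := exists_line_of_dist_add hgc hγ hγx hx
  obtain ⟨M, hM, hMγ, hyM⟩ := exists_line_of_dist_add hgc hγ hγy hy
  rw [← hns q b γ hγ hqb L M hL hM hLγ hMγ] at hyM
  obtain ⟨v, rfl⟩ := hyM
  obtain ⟨s, rfl⟩ := hLγ ⟨0, ⟨le_rfl, dist_nonneg⟩, hγ.1⟩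
  obtain ⟨t, rfl⟩ := hLγ ⟨_, ⟨dist_nonneg, le_rfl⟩, hγ.2.1⟩
  have hst : s ≠ t := fun h => hqb (by rw [h])
  simp only [hL.dist_eq, Real.dist_eq] at hx hy hxy
  congr 1
  grind

/-- A nondegenerate segment can be extended beyond its endpoint by any length. -/
lemma exists_extension [MetricSpace X] (hug : IsUniquelyGeodesic X)
    (hgc : IsGeodesicallyComplete X) {a b : X} (hab : a ≠ b) {e : ℝ} (he : 0 ≤ e) :
    ∃ q, dist b q = e ∧ dist a q = dist a b + e := by
  obtain ⟨γ, hγ⟩ := (hug a b).1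
  obtain ⟨L, hL, hsub⟩ := hgc a b γ hγ
  obtain ⟨s, rfl⟩ := hsub ⟨0, ⟨le_rfl, dist_nonneg⟩, hγ.1⟩
  obtain ⟨t, rfl⟩ := hsub ⟨_, ⟨dist_nonneg, le_rfl⟩, hγ.2.1⟩
  have hst : s ≠ t := fun h => hab (by rw [h])
  rcases hst.lt_or_gt with h | h
  · refine ⟨L (t + e), ?_⟩
    simp only [hL.dist_eq, Real.dist_eq]
    grind
  · refine ⟨L (t - e), ?_⟩
    simp only [hL.dist_eq, Real.dist_eq]
    grind

/-- A closed set containing the midpoints of its pairs of points is convex. -/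
lemma IsClosed.isGeodConvex [MetricSpace X] {m : X → X → X}
    (hmid : ∀ (x y : X) (γ : ℝ → X), IsGeodesicSegment γ x y → m x y = γ (dist x y / 2))
    {C : Set X} (hC : IsClosed C) (hm : MConvexSet m C) : IsGeodConvex C := by
  rintro a ha b hb γ ⟨h0, h1, hγ⟩ _ ⟨t, ht, rfl⟩
  have hd : (0 : ℝ) ≤ dist a b := dist_nonneg
  have hcont : ContinuousOn γ (Icc 0 (dist a b)) := by
    refine LipschitzOnWith.continuousOn (K := 1) (LipschitzOnWith.of_dist_le_mul ?_)
    intro x hx y hy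
    rw [hγ x hx y hy, NNReal.coe_one, one_mul, Real.dist_eq]
  set S := Icc 0 (dist a b) ∩ γ ⁻¹' C
  have hScl : IsClosed S := hcont.preimage_isClosed_of_isClosed isClosed_Icc hC
  have hmidS : ∀ s ∈ S, ∀ u ∈ S, s ≤ u → (s + u) / 2 ∈ S := by
    rintro s ⟨⟨hs0, hs1⟩, hsC⟩ u ⟨⟨hu0, hu1⟩, huC⟩ hsu
    refine ⟨⟨by linarith, by linarith⟩, ?_⟩
    have hdist : dist (γ s) (γ u) = u - s := by
      rw [hγ s ⟨hs0, hs1⟩ u ⟨hu0, hu1⟩, abs_of_nonpos (by linarith)]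
      ring
    have hseg : IsGeodesicSegment (fun v => γ (s + v)) (γ s) (γ u) := by
      refine ⟨by simp, by simp [hdist], ?_⟩
      rw [hdist]
      rintro v ⟨hv0, hv1⟩ w ⟨hw0, hw1⟩
      rw [hγ _ ⟨by linarith, by linarith⟩ _ ⟨by linarith, by linarith⟩]
      congr 1
      ring
    have := hm _ hsC _ huC
    rw [hmid _ _ _ hseg, hdist] at this
    rw [mem_preimage]
    convert this using 2
    ring
  have hl : (S ∩ Icc 0 t).Nonempty := ⟨0, ⟨⟨le_rfl, hd⟩, by rwa [mem_preimage, h0]⟩, le_rfl, ht.1⟩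
  have hr : (S ∩ Icc t (dist a b)).Nonempty :=
    ⟨dist a b, ⟨⟨hd, le_rfl⟩, by rwa [mem_preimage, h1]⟩, ht.2, le_rfl⟩
  obtain ⟨s, ⟨hsS, hst⟩, hs⟩ := (isCompact_Icc.inter_left hScl).exists_isGreatest hl
  obtain ⟨u, ⟨huS, hut⟩, hu⟩ := (isCompact_Icc.inter_left hScl).exists_isLeast hr
  have hM := hmidS s hsS u huS (hst.2.trans hut.1)
  rcases le_total ((s + u) / 2) t with h | h
  · have := hs ⟨hM, hM.1.1, h⟩
    have : s = t := by linarith [hst.2, hut.1]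
    exact this ▸ hsS.2
  · have := hu ⟨hM, h, hM.1.2⟩
    have : u = t := by linarith [hst.2, hut.1]
    exact this ▸ huS.2

lemma mConvexSet_closedBall [MetricSpace X] {m : X → X → X} (hconv : IsConvexMidpointMap m)
    (q : X) (R : ℝ) : MConvexSet m (closedBall q R) := by
  intro x hx y hy
  rw [mem_closedBall] at *
  have hq : m q q = q := dist_eq_zero.1 (by simpa using (hconv.1.2 q q).1)
  have := hconv.2 x q y q
  rw [hq] at this
  linarith

lemma mem_cthickening_iff_of_isCompact [MetricSpace X] {A : Set X} (hA : IsCompact A) {r : ℝ}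
    (hr : 0 ≤ r) {x : X} : x ∈ cthickening r A ↔ ∃ a ∈ A, dist x a ≤ r := by
  simp [hA.cthickening_eq_biUnion_closedBall hr]

lemma mConvexSet_cthickening [MetricSpace X] {m : X → X → X} (hconv : IsConvexMidpointMap m)
    {A : Set X} (hA : IsCompact A) (hAm : MConvexSet m A) {r : ℝ} (hr : 0 ≤ r) :
    MConvexSet m (cthickening r A) := by
  intro x hx y hy
  rw [mem_cthickening_iff_of_isCompact hA hr] at *
  obtain ⟨a, ha, hxa⟩ := hx
  obtain ⟨b, hb, hyb⟩ := hy
  exact ⟨m a b, hAm a ha b hb, by linarith [hconv.2 x a y b]⟩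

lemma MConvexSet.inter [MetricSpace X] {m : X → X → X} {A B : Set X} (hA : MConvexSet m A)
    (hB : MConvexSet m B) : MConvexSet m (A ∩ B) :=
  fun x hx y hy => ⟨hA x hx.1 y hy.1, hB x hx.2 y hy.2⟩

lemma IsGeodConvex.mConvexSet [MetricSpace X] (hug : IsUniquelyGeodesic X) {m : X → X → X}
    (hmid : ∀ (x y : X) (γ : ℝ → X), IsGeodesicSegment γ x y → m x y = γ (dist x y / 2))
    {A : Set X} (hA : IsGeodConvex A) : MConvexSet m A := by
  intro a ha b hb
  obtain ⟨γ, hγ⟩ := (hug a b).1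
  rw [hmid a b γ hγ]
  have : (0 : ℝ) ≤ dist a b := dist_nonneg
  exact hA a ha b hb γ hγ ⟨_, ⟨by linarith, by linarith⟩, rfl⟩

/-- A lower bound for the Hausdorff distance of compact sets is attained at a point of one set. -/
lemma ConvexCompacts.exists_mem_of_le_dist [MetricSpace X] {A B : ConvexCompacts X} {c : ℝ}
    (h : c ≤ dist A B) :
    (∃ a ∈ (A.1 : Set X), ∀ b ∈ (B.1 : Set X), c ≤ dist a b) ∨
      ∃ b ∈ (B.1 : Set X), ∀ a ∈ (A.1 : Set X), c ≤ dist a b := by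
  obtain ⟨a, ha, hamax⟩ := A.1.isCompact.exists_isMaxOn A.1.nonempty
    (continuous_infDist_pt (B.1 : Set X)).continuousOn
  obtain ⟨b, hb, hbmax⟩ := B.1.isCompact.exists_isMaxOn B.1.nonempty
    (continuous_infDist_pt (A.1 : Set X)).continuousOn
  have hle : dist A B ≤ max (infDist a B.1) (infDist b A.1) :=
    hausdorffDist_le_of_infDist (le_max_of_le_left infDist_nonneg)
      (fun x hx => le_max_of_le_left (hamax hx)) (fun x hx => le_max_of_le_right (hbmax hx))
  rcases le_max_iff.1 (h.trans hle) with h | h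
  · exact Or.inl ⟨a, ha, fun y hy => h.trans (infDist_le_dist_of_mem hy)⟩
  · exact Or.inr ⟨b, hb, fun y hy => dist_comm b y ▸ h.trans (infDist_le_dist_of_mem hy)⟩

lemma ConvexCompacts.le_dist_of_mem [MetricSpace X] {A B : ConvexCompacts X} {c : ℝ} {a : X}
    (ha : a ∈ (A.1 : Set X)) (h : ∀ b ∈ (B.1 : Set X), c ≤ dist a b) : c ≤ dist A B :=
  ((le_infDist B.1.nonempty).2 fun _ hy => h _ hy).trans
    (infDist_le_hausdorffDist_of_mem ha
      (hausdorffEDist_ne_top_of_nonempty_of_bounded A.1.nonempty B.1.nonempty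
        A.1.isCompact.isBounded B.1.isCompact.isBounded))

lemma dist_le_of_mem_of_dist_singletonCC_le [MetricSpace X] {p : X} {A : ConvexCompacts X} {r : ℝ}
    (h : dist A (singletonCC p) ≤ r) {x : X} (hx : x ∈ (A.1 : Set X)) : dist p x ≤ r := by
  refine le_trans ?_ h
  refine ConvexCompacts.le_dist_of_mem hx fun b hb => ?_
  obtain rfl : b = p := hb
  rw [dist_comm]

/-- Two sets in the `r`-ball around a point, at distance at least `2 r` from each other, are not
both nondegenerate. -/
lemma subsingleton_or_subsingleton [MetricSpace X] (hug : IsUniquelyGeodesic X)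
    (hgc : IsGeodesicallyComplete X) (hns : GeodesicsDoNotSplit X) {p : X} {r : ℝ} (hr : 0 < r)
    {A B : ConvexCompacts X} (hA : dist A (singletonCC p) ≤ r) (hB : dist B (singletonCC p) ≤ r)
    (hAB : 2 * r ≤ dist A B) : (A.1 : Set X).Subsingleton ∨ (B.1 : Set X).Subsingleton := by
  have key : ∀ {A B : ConvexCompacts X}, dist A (singletonCC p) ≤ r →
      dist B (singletonCC p) ≤ r → ∀ a ∈ (A.1 : Set X),
      (∀ b ∈ (B.1 : Set X), 2 * r ≤ dist a b) → (B.1 : Set X).Subsingleton := by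
    intro A B hA hB a ha h x hx y hy
    have h1 := dist_le_of_mem_of_dist_singletonCC_le hA ha
    have h2 := dist_le_of_mem_of_dist_singletonCC_le hB hx
    have h3 := dist_le_of_mem_of_dist_singletonCC_le hB hy
    have h4 := h x hx
    have h5 := h y hy
    have h6 := dist_triangle a p x
    have h7 := dist_triangle a p y
    have h8 := dist_comm a p
    refine extension_unique hug hgc hns (q := a) (b := p) ?_ (by linarith) (by linarith)
      (by linarith)
    rintro rfl
    linarith [dist_self a]
  rcases ConvexCompacts.exists_mem_of_le_dist hAB with ⟨a, ha, h⟩ | ⟨b, hb, h⟩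
  · exact Or.inr (key hA hB a ha h)
  · exact Or.inl (key hB hA b hb fun a ha => dist_comm a b ▸ h a ha)

/-- The `r`-ball around a point contains no three singletons at mutual distance at least `2 r`. -/
lemma not_three_singletons [MetricSpace X] (hug : IsUniquelyGeodesic X)
    (hgc : IsGeodesicallyComplete X) (hns : GeodesicsDoNotSplit X) {p : X} {r : ℝ} (hr : 0 < r)
    {A B C : ConvexCompacts X} (hA : dist A (singletonCC p) ≤ r)
    (hB : dist B (singletonCC p) ≤ r) (hC : dist C (singletonCC p) ≤ r)
    (hAB : 2 * r ≤ dist A B) (hAC : 2 * r ≤ dist A C) (hBC : 2 * r ≤ dist B C)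
    (hA' : (A.1 : Set X).Subsingleton) (hB' : (B.1 : Set X).Subsingleton)
    (hC' : (C.1 : Set X).Subsingleton) : False := by
  obtain ⟨a, ha⟩ := A.1.nonempty
  obtain ⟨b, hb⟩ := B.1.nonempty
  obtain ⟨c, hc⟩ := C.1.nonempty
  have aux : ∀ {A B : ConvexCompacts X} {a b : X}, 2 * r ≤ dist A B → a ∈ (A.1 : Set X) →
      b ∈ (B.1 : Set X) → (A.1 : Set X).Subsingleton → (B.1 : Set X).Subsingleton →
      2 * r ≤ dist a b := by
    intro A B a b h ha hb hA hB
    rcases ConvexCompacts.exists_mem_of_le_dist h with ⟨a', ha', h⟩ | ⟨b', hb', h⟩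
    · exact hA ha' ha ▸ h b hb
    · exact hB hb' hb ▸ h a ha
  have hab := aux hAB ha hb hA' hB'
  have hac := aux hAC ha hc hA' hC'
  have hbc := aux hBC hb hc hB' hC'
  have h1 := dist_le_of_mem_of_dist_singletonCC_le hA ha
  have h2 := dist_le_of_mem_of_dist_singletonCC_le hB hb
  have h3 := dist_le_of_mem_of_dist_singletonCC_le hC hc
  have h4 := dist_comm p a
  have h5 := dist_triangle a p b
  have h6 := dist_triangle a p c
  have : b = c := by
    refine extension_unique hug hgc hns (q := a) (b := p) ?_ (by linarith) (by linarith)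
      (by linarith)
    rintro rfl
    linarith [dist_self a]
  subst this
  linarith [dist_self b]

/-- The `r`-ball around a point contains no four sets at mutual distance at least `2 r`. -/
lemma not_four_separated [MetricSpace X] (hug : IsUniquelyGeodesic X)
    (hgc : IsGeodesicallyComplete X) (hns : GeodesicsDoNotSplit X) {p : X} {r : ℝ} (hr : 0 < r)
    (W : Fin 4 → ConvexCompacts X) (hW : ∀ i, dist (W i) (singletonCC p) ≤ r)
    (hsep : ∀ i j, i < j → 2 * r ≤ dist (W i) (W j)) : False := by
  have h : ∀ i j, i < j → ((W i).1 : Set X).Subsingleton ∨ ((W j).1 : Set X).Subsingleton :=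
    fun i j hij => subsingleton_or_subsingleton hug hgc hns hr (hW i) (hW j) (hsep i j hij)
  have h3 : ∀ i j k, i < j → j < k → ((W i).1 : Set X).Subsingleton →
      ((W j).1 : Set X).Subsingleton → ((W k).1 : Set X).Subsingleton → False :=
    fun i j k hij hjk => not_three_singletons hug hgc hns hr (hW i) (hW j) (hW k)
      (hsep i j hij) (hsep i k (hij.trans hjk)) (hsep j k hjk)
  by_cases h0 : ((W 0).1 : Set X).Subsingleton
  · by_cases h1 : ((W 1).1 : Set X).Subsingleton
    · rcases h 2 3 (by decide) with h2 | h2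
      · exact h3 0 1 2 (by decide) (by decide) h0 h1 h2
      · exact h3 0 1 3 (by decide) (by decide) h0 h1 h2
    · exact h3 0 2 3 (by decide) (by decide) h0 ((h 1 2 (by decide)).resolve_left h1)
        ((h 1 3 (by decide)).resolve_left h1)
  · exact h3 1 2 3 (by decide) (by decide) ((h 0 1 (by decide)).resolve_left h0)
      ((h 0 2 (by decide)).resolve_left h0) ((h 0 3 (by decide)).resolve_left h0)

/-- A point of a set of diameter `dist a b` which is as far as `a` from a point `q` on the
extension of the segment from `a` to `b` equals `a`. -/
lemma eq_of_dist_extension [MetricSpace X] (hug : IsUniquelyGeodesic X)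
    (hgc : IsGeodesicallyComplete X) (hns : GeodesicsDoNotSplit X) {a b q x : X} {e : ℝ}
    (he : 0 < e) (hbq : dist b q = e) (haq : dist a q = dist a b + e)
    (hx : dist b x ≤ dist a b) (hxq : dist a b + e ≤ dist x q) : x = a := by
  have h1 := dist_comm b q
  have h2 := dist_comm a q
  have h3 := dist_comm x q
  have h4 := dist_comm a b
  have h5 := dist_triangle q b x
  refine extension_unique hug hgc hns (q := q) (b := b) ?_ (by linarith) (by linarith)
    (by linarith)
  rintro rfl
  linarith [dist_self q]

/-- A point can be moved by `r` towards any point at distance at least `r`. -/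
lemma exists_dist_eq_sub [MetricSpace X] (hug : IsUniquelyGeodesic X) {x q : X} {r : ℝ}
    (hr : 0 ≤ r) (h : r ≤ dist x q) : ∃ y, dist x y = r ∧ dist y q = dist x q - r := by
  obtain ⟨γ, h0, h1, hγ⟩ := (hug x q).1
  refine ⟨γ r, ?_, ?_⟩
  · have := hγ 0 ⟨le_rfl, hr.trans h⟩ r ⟨hr, h⟩
    rwa [h0, zero_sub, abs_neg, abs_of_nonneg hr] at this
  · have := hγ r ⟨hr, h⟩ _ ⟨hr.trans h, le_rfl⟩
    rw [h1, abs_of_nonpos (by linarith)] at this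
    linarith

/-- Around every nondegenerate set there are, for some `r > 0`, four sets within distance `r`
at mutual distance at least `2 r`. -/
lemma exists_four_separated [MetricSpace X] [ProperSpace X]
    (hug : IsUniquelyGeodesic X) (hgc : IsGeodesicallyComplete X)
    (hns : GeodesicsDoNotSplit X) {m : X → X → X}
    (hmid : ∀ (x y : X) (γ : ℝ → X), IsGeodesicSegment γ x y → m x y = γ (dist x y / 2))
    (hconv : IsConvexMidpointMap m) (A : ConvexCompacts X)
    (hA : (A.1 : Set X).Nontrivial) :
    ∃ r > 0, ∃ Z : Fin 4 → ConvexCompacts X, (∀ i, dist (Z i) A ≤ r) ∧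
      ∀ i j, i < j → 2 * r ≤ dist (Z i) (Z j) := by
  have hAc : IsCompact (A.1 : Set X) := A.1.isCompact
  obtain ⟨⟨a, b⟩, ⟨ha, hb⟩, hmax⟩ := (hAc.prod hAc).exists_isMaxOn
    (A.1.nonempty.prod A.1.nonempty) continuous_dist.continuousOn
  replace hmax : ∀ x ∈ (A.1 : Set X), ∀ y ∈ (A.1 : Set X), dist x y ≤ dist a b :=
    fun x hx y hy => hmax (mk_mem_prod hx hy)
  simp only at ha hb
  have hab : 0 < dist a b := by
    obtain ⟨x, hx, y, hy, hxy⟩ := hA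
    exact (dist_pos.2 hxy).trans_le (hmax x hx y hy)
  have hne : a ≠ b := dist_pos.1 hab
  obtain ⟨q, hbq, haq⟩ := exists_extension hug hgc hne zero_le_one
  obtain ⟨q', haq', hbq'⟩ := exists_extension hug hgc hne.symm zero_le_one
  rw [dist_comm b a] at hbq'
  obtain ⟨x₀, hx₀, hx₀max⟩ := hAc.exists_isMaxOn A.1.nonempty
    (f := fun x => min (dist x q) (dist x q')) (by fun_prop)
  have hx₀lt : min (dist x₀ q) (dist x₀ q') < dist a b + 1 := by
    by_contra! h
    have h1 := eq_of_dist_extension hug hgc hns one_pos hbq haq (hmax b hb x₀ hx₀)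
      (h.trans (min_le_left _ _))
    have h2 := eq_of_dist_extension (a := b) (b := a) (x := x₀) hug hgc hns one_pos haq'
      (by rw [hbq', dist_comm b a]) (by rw [dist_comm b a]; exact hmax a ha x₀ hx₀)
      (by rw [dist_comm b a]; exact h.trans (min_le_right _ _))
    exact hne (h1.symm.trans h2)
  obtain ⟨r, hr, hrab, hrx⟩ : ∃ r > 0, 2 * r ≤ dist a b ∧
      min (dist x₀ q) (dist x₀ q') ≤ dist a b + 1 - 2 * r := by
    refine ⟨min (dist a b) (dist a b + 1 - min (dist x₀ q) (dist x₀ q')) / 2,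
      half_pos (lt_min hab (by linarith)), ?_, ?_⟩
    · linarith [min_le_left (dist a b) (dist a b + 1 - min (dist x₀ q) (dist x₀ q'))]
    · linarith [min_le_right (dist a b) (dist a b + 1 - min (dist x₀ q) (dist x₀ q'))]
  set R := dist a b + 1 - r with hR
  have hnear : ∀ x ∈ (A.1 : Set X), dist x q ≤ R - r ∨ dist x q' ≤ R - r := by
    intro x hx
    rw [← min_le_iff]
    exact (hx₀max hx).trans (by linarith)
  have hup : ∀ x ∈ (A.1 : Set X), dist x q ≤ R + r ∧ dist x q' ≤ R + r := by
    intro x hx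
    have h1 := dist_triangle x b q
    have h2 := dist_triangle x a q'
    exact ⟨by linarith [hmax x hx b hb], by linarith [hmax x hx a ha]⟩
  have hmove : ∀ {x q q' : X}, dist x q ≤ R + r → dist x q' ≤ R - r →
      ∃ y, dist x y ≤ r ∧ dist y q ≤ R ∧ dist y q' ≤ R := by
    intro x q q' h h'
    rcases le_total (dist x q) R with h1 | h1
    · exact ⟨x, by simpa using hr.le, h1, by linarith⟩
    · obtain ⟨y, hy, hyq⟩ := exists_dist_eq_sub hug hr.le (show r ≤ dist x q by linarith)
      exact ⟨y, hy.le, by linarith, by linarith [dist_triangle y x q', dist_comm x y]⟩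
  have hshrink : ∀ x ∈ (A.1 : Set X), ∃ y, dist x y ≤ r ∧ dist y q ≤ R ∧ dist y q' ≤ R := by
    intro x hx
    rcases hnear x hx with h | h
    · obtain ⟨y, h1, h2, h3⟩ := hmove (hup x hx).2 h
      exact ⟨y, h1, h3, h2⟩
    · exact hmove (hup x hx).1 h
  obtain ⟨a', haa', hqa'⟩ := exists_extension hug hgc (a := q) (b := a)
    (by rintro rfl; linarith [dist_self q]) hr.le
  obtain ⟨b', hbb', hqb'⟩ := exists_extension hug hgc (a := q') (b := b)
    (by rintro rfl; linarith [dist_self q']) hr.le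
  rw [dist_comm q a, haq] at hqa'
  rw [dist_comm q' b, hbq'] at hqb'
  set N := cthickening r (A.1 : Set X)
  have hmemN : ∀ x, x ∈ N ↔ ∃ a ∈ (A.1 : Set X), dist x a ≤ r :=
    fun x => mem_cthickening_iff_of_isCompact hAc hr.le
  have hNc : IsCompact N := hAc.cthickening
  have hNm : MConvexSet m N := mConvexSet_cthickening hconv hAc (A.2.mConvexSet hug hmid) hr.le
  have ha'N : a' ∈ N := (hmemN a').2 ⟨a, ha, by rw [dist_comm, haa']⟩
  have hb'N : b' ∈ N := (hmemN b').2 ⟨b, hb, by rw [dist_comm, hbb']⟩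
  have ha'q' : a' ∈ closedBall q' R := by
    rw [mem_closedBall]
    linarith [dist_triangle a' a q', dist_comm a a']
  have hb'q : b' ∈ closedBall q R := by
    rw [mem_closedBall]
    linarith [dist_triangle b' b q, dist_comm b b']
  have hexists : ∀ S : Set X, IsClosed S → MConvexSet m S →
      closedBall q R ∩ closedBall q' R ⊆ S →
      ∃ Z : ConvexCompacts X, (Z.1 : Set X) = N ∩ S ∧ dist Z A ≤ r := by
    intro S hS hSm hsub
    have hy : ∀ x ∈ (A.1 : Set X), ∃ y ∈ N ∩ S, dist x y ≤ r := by
      intro x hx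
      obtain ⟨y, h1, h2, h3⟩ := hshrink x hx
      exact ⟨y, ⟨(hmemN y).2 ⟨x, hx, by rwa [dist_comm]⟩, hsub ⟨h2, h3⟩⟩, h1⟩
    have hne : (N ∩ S).Nonempty := by
      obtain ⟨y, hy, -⟩ := hy a ha
      exact ⟨y, hy⟩
    refine ⟨⟨⟨⟨N ∩ S, hNc.inter_right hS⟩, hne⟩,
      (hNc.isClosed.inter hS).isGeodConvex hmid (hNm.inter hSm)⟩, rfl, ?_⟩
    exact hausdorffDist_le_of_mem_dist hr.le (fun x hx => (hmemN x).1 hx.1) hy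
  have hBm := mConvexSet_closedBall hconv q R
  have hBm' := mConvexSet_closedBall hconv q' R
  obtain ⟨Z₀, hZ₀, hd₀⟩ := hexists univ isClosed_univ (fun _ _ _ _ => trivial) (subset_univ _)
  obtain ⟨Z₁, hZ₁, hd₁⟩ := hexists _ isClosed_closedBall hBm inter_subset_left
  obtain ⟨Z₂, hZ₂, hd₂⟩ := hexists _ isClosed_closedBall hBm' inter_subset_right
  obtain ⟨Z₃, hZ₃, hd₃⟩ :=
    hexists _ (isClosed_closedBall.inter isClosed_closedBall) (hBm.inter hBm') subset_rfl
  have hsepa : ∀ {Z W : ConvexCompacts X}, a' ∈ (Z.1 : Set X) →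
      (W.1 : Set X) ⊆ closedBall q R → 2 * r ≤ dist Z W := fun hZ hW =>
    ConvexCompacts.le_dist_of_mem hZ fun w hw => by
      have := mem_closedBall.1 (hW hw)
      linarith [dist_triangle q w a', dist_comm q w, dist_comm w a']
  have hsepb : ∀ {Z W : ConvexCompacts X}, b' ∈ (Z.1 : Set X) →
      (W.1 : Set X) ⊆ closedBall q' R → 2 * r ≤ dist Z W := fun hZ hW =>
    ConvexCompacts.le_dist_of_mem hZ fun w hw => by
      have := mem_closedBall.1 (hW hw)
      linarith [dist_triangle q' w b', dist_comm q' w, dist_comm w b']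
  have h01 : 2 * r ≤ dist Z₀ Z₁ :=
    hsepa (by rw [hZ₀]; exact ⟨ha'N, trivial⟩) (by rw [hZ₁]; exact inter_subset_right)
  have h02 : 2 * r ≤ dist Z₀ Z₂ :=
    hsepb (by rw [hZ₀]; exact ⟨hb'N, trivial⟩) (by rw [hZ₂]; exact inter_subset_right)
  have h03 : 2 * r ≤ dist Z₀ Z₃ :=
    hsepa (by rw [hZ₀]; exact ⟨ha'N, trivial⟩) (by rw [hZ₃]; exact fun _ h => h.2.1)
  have h12 : 2 * r ≤ dist Z₁ Z₂ :=
    hsepb (by rw [hZ₁]; exact ⟨hb'N, hb'q⟩) (by rw [hZ₂]; exact inter_subset_right)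
  have h13 : 2 * r ≤ dist Z₁ Z₃ :=
    hsepb (by rw [hZ₁]; exact ⟨hb'N, hb'q⟩) (by rw [hZ₃]; exact fun _ h => h.2.2)
  have h23 : 2 * r ≤ dist Z₂ Z₃ :=
    hsepa (by rw [hZ₂]; exact ⟨ha'N, ha'q'⟩) (by rw [hZ₃]; exact fun _ h => h.2.1)
  refine ⟨r, hr, ![Z₀, Z₁, Z₂, Z₃], ?_, ?_⟩
  · intro i
    fin_cases i <;> assumption
  · intro i j hij
    fin_cases i <;> fin_cases j <;> first | assumption | exact absurd hij (by decide)

/-- **Lemma 3.3.** Under the hypotheses of Theorem 1.1, every surjective isometry of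
`𝒞(X,d)` maps singletons to singletons. -/
theorem image_of_points_are_points [MetricSpace X] [ProperSpace X]
    (hug : IsUniquelyGeodesic X) (hgc : IsGeodesicallyComplete X)
    (hns : GeodesicsDoNotSplit X)
    (m : X → X → X)
    (hmid : ∀ (x y : X) (γ : ℝ → X), IsGeodesicSegment γ x y → m x y = γ (dist x y / 2))
    (hconv : IsConvexMidpointMap m)
    (I : ConvexCompacts X ≃ᵢ ConvexCompacts X) :
    ∀ p : X, ∃ x : X, ((I (singletonCC p)).1 : Set X) = {x} := by
  intro p
  by_contra h
  have hnt : ((I (singletonCC p)).1 : Set X).Nontrivial :=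
    (I (singletonCC p)).1.nonempty.exists_eq_singleton_or_nontrivial.resolve_left h
  obtain ⟨r, hr, Z, hZ, hsep⟩ := exists_four_separated hug hgc hns hmid hconv _ hnt
  refine not_four_separated hug hgc hns (p := p) hr (fun i => I.symm (Z i)) ?_ ?_
  · intro i
    rw [← I.dist_eq, I.apply_symm_apply]
    exact hZ i
  · intro i j hij
    rw [I.symm.dist_eq]
    exact hsep i j hij
end
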